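/- arXiv:cs/0209012 — 2 statements merged into one kernel-verified Lean document; each statement's English description precedes it below -/
import Mathlib

section
/- Let 0 < α ≤ 2π/3, let R > 0, let V be a finite set of points of the Euclidean plane, and let r : V → ℝ be a CBTC(α)-valid radius assignment. Then for all u, v ∈ V that are joined by a path in G_R, there exists a finite sequence of points u = u_0, u_1, …, u_k = v in V such that every consecutive pair is a directed edge of N_α, i.e. for every i < k, u_i ≠ u_{i+1} and dist u_i u_{i+1} ≤ r u_i. (Thus for α ≤ 2π/3, connectivity is preserved even without taking the symmetric closure of N_α.) -/
open EuclideanGeometry Real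

noncomputable section

/-- The Euclidean plane. -/
abbrev EPlane := EuclideanSpace ℝ (Fin 2)

/-- Adjacency in the graph `G_R`: two distinct points of `V` at distance at most `R`. -/
def GRAdj (R : ℝ) (V : Finset EPlane) (u v : EPlane) : Prop :=
  u ∈ V ∧ v ∈ V ∧ u ≠ v ∧ dist u v ≤ R

/-- A radius assignment `r` is CBTC(α)-valid if every `u ∈ V` has `0 < r u ≤ R` and
either `r u = R` or `u` has no α-gap: every direction `e` is within angle `α/2`
of some neighbor of `u` at distance at most `r u`. -/
def CBTCValid (α R : ℝ) (V : Finset EPlane) (r : EPlane → ℝ) : Prop :=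
  ∀ u ∈ V, (0 < r u ∧ r u ≤ R) ∧
    (r u = R ∨ ∀ e : EPlane, e ≠ 0 → ∃ v ∈ V, v ≠ u ∧ dist u v ≤ r u ∧
      InnerProductGeometry.angle (v - u) e ≤ α / 2)

/-- Adjacency in the graph `G_α` (symmetric closure of `N_α`):
two distinct points of `V` with `dist u v ≤ max (r u) (r v)`. -/
def GAlphaAdj (V : Finset EPlane) (r : EPlane → ℝ) (u v : EPlane) : Prop :=
  u ∈ V ∧ v ∈ V ∧ u ≠ v ∧ dist u v ≤ max (r u) (r v)

/-- The directed edges of `N_α` between points of `V`. -/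
def NAlphaAdj (V : Finset EPlane) (r : EPlane → ℝ) (u v : EPlane) : Prop :=
  u ∈ V ∧ v ∈ V ∧ u ≠ v ∧ dist u v ≤ r u

theorem dist_lt_of_angle_le_pi_div_three {E : Type*} [NormedAddCommGroup E]
    [InnerProductSpace ℝ E] {u v w : E} (hw : w ≠ u) (hlt : dist u w < dist u v)
    (h : InnerProductGeometry.angle (w - u) (v - u) ≤ Real.pi / 3) :
    dist w v < dist u v := by
  have hcos : 1 / 2 ≤ Real.cos (InnerProductGeometry.angle (w - u) (v - u)) := by
    rw [← Real.cos_pi_div_three]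
    exact Real.cos_le_cos_of_nonneg_of_le_pi (InnerProductGeometry.angle_nonneg _ _)
      (by linarith [Real.pi_pos]) h
  have hlaw := norm_sub_sq_real (w - u) (v - u)
  rw [← InnerProductGeometry.cos_angle_mul_norm_mul_norm, sub_sub_sub_cancel_right] at hlaw
  rw [dist_comm u w, dist_comm u v, dist_eq_norm, dist_eq_norm] at hlt
  rw [dist_comm u v, dist_eq_norm, dist_eq_norm]
  have hpos : 0 < ‖w - u‖ := norm_pos_iff.2 (sub_ne_zero.2 hw)
  have hprod : 0 < ‖w - u‖ * ‖v - u‖ := mul_pos hpos (hpos.trans hlt)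
  refine lt_of_pow_lt_pow_left₀ 2 (norm_nonneg _) ?_
  nlinarith [mul_le_mul_of_nonneg_right hcos hprod.le, mul_lt_mul_of_pos_left hlt hpos]

theorem CBTCValid.exists_closer {α R : ℝ} {V : Finset EPlane} {r : EPlane → ℝ}
    (hr : CBTCValid α R V r) (hα : α ≤ 2 * Real.pi / 3) {u v : EPlane} (hu : u ∈ V)
    (hR : dist u v ≤ R) (hlt : r u < dist u v) :
    ∃ w, NAlphaAdj V r u w ∧ dist w v < dist u v := by
  obtain ⟨⟨hpos, -⟩, heq | hgap⟩ := hr u hu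
  · linarith
  · have hne : v - u ≠ 0 := by
      rw [sub_ne_zero]
      exact (dist_pos.1 (hpos.trans hlt)).symm
    obtain ⟨w, hw, hwu, hd, hang⟩ := hgap (v - u) hne
    exact ⟨w, ⟨hu, hw, hwu.symm, hd⟩,
      dist_lt_of_angle_le_pi_div_three hwu (hd.trans_lt hlt) (by linarith)⟩

theorem CBTCValid.reachable_of_dist_le {α R : ℝ} {V : Finset EPlane} {r : EPlane → ℝ}
    (hr : CBTCValid α R V r) (hα : α ≤ 2 * Real.pi / 3) {u v : EPlane} (hu : u ∈ V)
    (hv : v ∈ V) (hR : dist u v ≤ R) : Relation.ReflTransGen (NAlphaAdj V r) u v := by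
  induction hn : (V.filter fun w => dist w v < dist u v).card using Nat.strong_induction_on
    generalizing u with
  | _ n ih =>
    rcases eq_or_ne u v with rfl | hne
    · exact .refl
    rcases le_or_gt (dist u v) (r u) with hle | hlt
    · exact .single ⟨hu, hv, hne, hle⟩
    · obtain ⟨w, hadj, hcl⟩ := hr.exists_closer hα hu hR hlt
      refine .head hadj (ih _ ?_ hadj.2.1 (hcl.le.trans hR) rfl)
      rw [← hn]
      refine Finset.card_lt_card (Finset.ssubset_iff_of_subset ?_ |>.2 ⟨w, ?_, ?_⟩)
      · exact Finset.monotone_filter_right _ fun x _ hx => hx.trans hcl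
      · exact Finset.mem_filter.2 ⟨hadj.2.1, hcl⟩
      · simp

theorem exists_path_of_reachable {V : Finset EPlane} {r : EPlane → ℝ} {u v : EPlane}
    (hv : v ∈ V) (h : Relation.ReflTransGen (NAlphaAdj V r) u v) :
    ∃ (k : ℕ) (p : ℕ → EPlane), p 0 = u ∧ p k = v ∧ (∀ i ≤ k, p i ∈ V) ∧
      ∀ i < k, p i ≠ p (i + 1) ∧ dist (p i) (p (i + 1)) ≤ r (p i) := by
  induction h using Relation.ReflTransGen.head_induction_on with
  | refl => exact ⟨0, fun _ => v, rfl, rfl, fun _ _ => hv, fun i hi => absurd hi i.not_lt_zero⟩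
  | @head a c hac _ ih =>
    obtain ⟨k, p, rfl, hk, hmem, hstep⟩ := ih
    refine ⟨k + 1, fun i => Nat.casesOn i a p, rfl, hk, ?_, ?_⟩
    · rintro (_ | i) hi
      · exact hac.1
      · exact hmem i (by omega)
    · rintro (_ | i) hi
      · exact hac.2.2
      · exact hstep i (by omega)

/-- For `0 < α ≤ 2π/3`, connectivity is preserved without taking the symmetric
closure of `N_α`: any two points joined by a path in `G_R` are joined by a
directed path of `N_α`-edges. -/
theorem cbtc_directed_connectivity (α R : ℝ) (hα : 0 < α) (hα' : α ≤ 2 * Real.pi / 3)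
    (hR : 0 < R) (V : Finset EPlane) (r : EPlane → ℝ) (hr : CBTCValid α R V r)
    (u v : EPlane) (hu : u ∈ V) (hv : v ∈ V)
    (hconn : Relation.ReflTransGen (GRAdj R V) u v) :
    ∃ (k : ℕ) (p : ℕ → EPlane), p 0 = u ∧ p k = v ∧ (∀ i ≤ k, p i ∈ V) ∧
      ∀ i < k, p i ≠ p (i + 1) ∧ dist (p i) (p (i + 1)) ≤ r (p i) := by
  refine exists_path_of_reachable hv ?_
  clear hu hv
  induction hconn with
  | refl => exact .refl
  | tail _ hbc ih => exact ih.trans (hr.reachable_of_dist_le hα' hbc.1 hbc.2.1 hbc.2.2.2)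
end
end

section
/- (Pairwise/redundant edge removal.) Let 0 < α ≤ 5π/6, let R > 0, let V be a finite set of points of the Euclidean plane, let r : V → ℝ be a CBTC(α)-valid radius assignment, and let id : V → ℕ be an injective function. Then the graph G_α^{nr} obtained from G_α by removing all redundant edges preserves the connectivity of G_R: for all u, v ∈ V, u and v are joined by a path in G_α^{nr} if and only if they are joined by a path in G_R. -/
open EuclideanGeometry Real

noncomputable section

/-- Lexicographic comparison of edge IDs: `eid (u,v) < eid (w,x)` where
`eid (u,v) = (dist u v, max (id u) (id v), min (id u) (id v))`. -/
def EidLt (nid : EPlane → ℕ) (u v w x : EPlane) : Prop :=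
  dist u v < dist w x ∨
    (dist u v = dist w x ∧
      (max (nid u) (nid v) < max (nid w) (nid x) ∨
        (max (nid u) (nid v) = max (nid w) (nid x) ∧
          min (nid u) (nid v) < min (nid w) (nid x))))

/-- The ordered pair `(u,v)` of `G_α`-adjacent points is redundant if there is a
`G_α`-neighbor `w` of `u` with `∠ v u w < π/3` and `eid (u,w) < eid (u,v)`. -/
def Redundant (V : Finset EPlane) (r : EPlane → ℝ) (nid : EPlane → ℕ)
    (u v : EPlane) : Prop :=
  GAlphaAdj V r u v ∧
    ∃ w, GAlphaAdj V r u w ∧ ∠ v u w < Real.pi / 3 ∧ EidLt nid u w u v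

/-- Adjacency in `G_α^{nr}`: `G_α`-adjacent and neither `(u,v)` nor `(v,u)` is
redundant. -/
def GAlphaNrAdj (V : Finset EPlane) (r : EPlane → ℝ) (nid : EPlane → ℕ)
    (u v : EPlane) : Prop :=
  GAlphaAdj V r u v ∧ ¬ Redundant V r nid u v ∧ ¬ Redundant V r nid v u

/-- If every direction is within `5π/12` of some angle in the finite set `S ⊆ (-π, π]`, then
two angles of `S` enclosing the direction `0` differ by at most `5π/6`. -/
lemma exists_enclosing_angles {ι : Type*} (S : Finset ι) (ψ : ι → ℝ)
    (hψ : ∀ i ∈ S, -π < ψ i ∧ ψ i ≤ π)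
    (hgap : ∀ m : ℝ, ∃ i ∈ S, cos (5 * π / 12) ≤ cos (ψ i - m)) :
    ∃ i ∈ S, ∃ j ∈ S, 0 ≤ ψ i ∧ ψ j ≤ 0 ∧ ψ i - ψ j ≤ 5 * π / 6 := by
  have hpi := Real.pi_pos
  have hpos : 0 < cos (5 * π / 12) := cos_pos_of_mem_Ioo ⟨by linarith, by linarith⟩
  have hupper : (S.filter fun i => 0 ≤ ψ i).Nonempty := by
    obtain ⟨i, hi, hc⟩ := hgap (π / 2)
    refine ⟨i, Finset.mem_filter.2 ⟨hi, ?_⟩⟩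
    by_contra! hneg
    rw [cos_sub_pi_div_two] at hc
    linarith [sin_neg_of_neg_of_neg_pi_lt hneg (hψ i hi).1]
  have hlower : (S.filter fun i => ψ i ≤ 0).Nonempty := by
    obtain ⟨i, hi, hc⟩ := hgap (-(π / 2))
    refine ⟨i, Finset.mem_filter.2 ⟨hi, ?_⟩⟩
    by_contra! hneg
    rw [sub_neg_eq_add, cos_add_pi_div_two] at hc
    linarith [sin_nonneg_of_nonneg_of_le_pi hneg.le (hψ i hi).2]
  obtain ⟨i, hi, hmin⟩ := Finset.exists_min_image _ ψ hupper
  obtain ⟨j, hj, hmax⟩ := Finset.exists_max_image _ ψ hlower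
  rw [Finset.mem_filter] at hi hj
  refine ⟨i, hi.1, j, hj.1, hi.2, hj.2, ?_⟩
  by_contra! hwide
  obtain ⟨k, hk, hc⟩ := hgap ((ψ i + ψ j) / 2)
  have hi' := hψ i hi.1
  have hj' := hψ j hj.1
  have hk' := hψ k hk
  have hlt : ∀ t : ℝ, 5 * π / 12 < t → t ≤ 2 * π - (ψ i - ψ j) / 2 →
      cos t < cos (5 * π / 12) := by
    intro t h1 h2
    rcases le_total t π with h | h
    · exact cos_lt_cos_of_nonneg_of_le_pi (by linarith) h h1
    · rw [← cos_two_pi_sub t]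
      exact cos_lt_cos_of_nonneg_of_le_pi (by linarith) (by linarith) (by linarith)
  rcases le_total 0 (ψ k) with h | h
  · have := hmin k (Finset.mem_filter.2 ⟨hk, h⟩)
    exact absurd hc (not_le.2 (hlt _ (by linarith) (by linarith)))
  · have := hmax k (Finset.mem_filter.2 ⟨hk, h⟩)
    rw [← cos_neg (ψ k - _)] at hc
    exact absurd hc (not_le.2 (hlt _ (by linarith) (by linarith)))

lemma exists_polar (X Y a : ℝ) (ha : 0 ≤ a) (h : a ^ 2 = X ^ 2 + Y ^ 2) :
    ∃ ψ : ℝ, -π < ψ ∧ ψ ≤ π ∧ X = a * cos ψ ∧ Y = a * sin ψ := by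
  have hn : ‖(⟨X, Y⟩ : ℂ)‖ = a := by
    rw [← sq_eq_sq₀ (norm_nonneg _) ha, Complex.sq_norm, Complex.normSq_mk, h]
    ring
  refine ⟨Complex.arg ⟨X, Y⟩, Complex.neg_pi_lt_arg _, Complex.arg_le_pi _, ?_, ?_⟩
  · rw [← hn, Complex.norm_mul_cos_arg]
  · rw [← hn, Complex.norm_mul_sin_arg]

/-- `f, g` is an orthonormal basis of the plane. -/
def IsFrame (f g : EPlane) : Prop :=
  (∀ x : EPlane, ‖x‖ ^ 2 = inner ℝ x f ^ 2 + inner ℝ x g ^ 2) ∧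
    ∀ c s : ℝ, ‖c • f + s • g‖ ^ 2 = c ^ 2 + s ^ 2

lemma IsFrame.neg_left {f g : EPlane} (h : IsFrame f g) : IsFrame (-f) g :=
  ⟨fun x => by rw [h.1 x, inner_neg_right, neg_sq],
    fun c s => by rw [smul_neg, ← neg_smul, h.2, neg_sq]⟩

lemma IsFrame.neg_right {f g : EPlane} (h : IsFrame f g) : IsFrame f (-g) :=
  ⟨fun x => by rw [h.1 x, inner_neg_right, neg_sq],
    fun c s => by rw [smul_neg, ← neg_smul, h.2, neg_sq]⟩

lemma exists_isFrame (D : EPlane) (hD : D ≠ 0) :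
    ∃ f g : EPlane, IsFrame f g ∧ inner ℝ D f = ‖D‖ ∧ inner ℝ D g = 0 := by
  have hd : 0 < ‖D‖ := norm_pos_iff.2 hD
  have hsq : ‖D‖ ^ 2 = D 0 ^ 2 + D 1 ^ 2 := by
    simp [EuclideanSpace.norm_sq_eq, Fin.sum_univ_two]
  have hpq : (D 0 / ‖D‖) ^ 2 + (D 1 / ‖D‖) ^ 2 = 1 := by
    field_simp
    linarith
  have h0 : D 0 = ‖D‖ * (D 0 / ‖D‖) := by field_simp
  have h1 : D 1 = ‖D‖ * (D 1 / ‖D‖) := by field_simp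
  generalize D 0 / ‖D‖ = p at *
  generalize D 1 / ‖D‖ = q at *
  refine ⟨!₂[p, q], !₂[-q, p], ⟨fun x => ?_, fun c s => ?_⟩, ?_, ?_⟩
  · simp [EuclideanSpace.norm_sq_eq, Fin.sum_univ_two, PiLp.inner_apply]
    linear_combination -(x 0 ^ 2 + x 1 ^ 2) * hpq
  · simp [EuclideanSpace.norm_sq_eq, Fin.sum_univ_two]
    linear_combination (c ^ 2 + s ^ 2) * hpq
  · simp [Fin.sum_univ_two, PiLp.inner_apply]
    rw [h0, h1]
    linear_combination ‖D‖ * hpq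
  · simp [Fin.sum_univ_two, PiLp.inner_apply]
    rw [h0, h1]
    ring

/-- A node without `5π/6`-gap has two neighbors enclosing a given direction `f` in a cone of
opening at most `5π/6`. -/
lemma exists_enclosing_vectors {f g : EPlane} (hfg : IsFrame f g) (S : Finset EPlane)
    (h0 : ∀ x ∈ S, x ≠ 0)
    (hgap : ∀ e : EPlane, e ≠ 0 → ∃ x ∈ S, InnerProductGeometry.angle x e ≤ 5 * π / 12) :
    ∃ x ∈ S, ∃ y ∈ S, ∃ ψ χ : ℝ, 0 ≤ ψ ∧ 0 ≤ χ ∧ ψ + χ ≤ 5 * π / 6 ∧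
      inner ℝ x f = ‖x‖ * cos ψ ∧ inner ℝ x g = ‖x‖ * sin ψ ∧
      inner ℝ y f = ‖y‖ * cos χ ∧ inner ℝ y (-g) = ‖y‖ * sin χ := by
  choose ψ hψ using fun x : EPlane =>
    exists_polar (inner ℝ x f) (inner ℝ x g) ‖x‖ (norm_nonneg x) (hfg.1 x)
  obtain ⟨x, hx, y, hy, hx0, hy0, hxy⟩ := exists_enclosing_angles S ψ
    (fun x _ => ⟨(hψ x).1, (hψ x).2.1⟩) (by
      intro m
      have hn : ‖cos m • f + sin m • g‖ = 1 := by
        rw [← sq_eq_sq₀ (norm_nonneg _) zero_le_one, hfg.2, one_pow, cos_sq_add_sin_sq]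
      obtain ⟨x, hx, hang⟩ := hgap (cos m • f + sin m • g)
        (by rw [← norm_pos_iff, hn]; exact one_pos)
      refine ⟨x, hx, ?_⟩
      have hx0 : 0 < ‖x‖ := norm_pos_iff.2 (h0 x hx)
      have hcos := cos_le_cos_of_nonneg_of_le_pi (InnerProductGeometry.angle_nonneg _ _)
        (by linarith [Real.pi_pos]) hang
      have hmul := InnerProductGeometry.cos_angle_mul_norm_mul_norm x (cos m • f + sin m • g)
      rw [hn, inner_add_right, inner_smul_right, inner_smul_right, (hψ x).2.2.1,
        (hψ x).2.2.2] at hmul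
      rw [cos_sub]
      refine hcos.trans (le_of_eq (mul_right_cancel₀ hx0.ne' ?_))
      linarith)
  refine ⟨x, hx, y, hy, ψ x, -ψ y, hx0, by linarith, by linarith, (hψ x).2.2.1, (hψ x).2.2.2,
    ?_, ?_⟩
  · rw [cos_neg, (hψ y).2.2.1]
  · rw [sin_neg, inner_neg_right, (hψ y).2.2.2, mul_neg]

/-- A monic quadratic that is negative at both ends of an interval is negative on it. -/
lemma monic_quadratic_neg {l h a p q : ℝ} (hlh : l < h) (hla : l ≤ a) (hah : a ≤ h)
    (hl : l ^ 2 + p * l + q < 0) (hh : h ^ 2 + p * h + q < 0) : a ^ 2 + p * a + q < 0 := by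
  have h1 : 0 ≤ (a - l) * (h - a) := mul_nonneg (by linarith) (by linarith)
  rcases hla.eq_or_lt with rfl | hla
  · exact hl
  have h2 := mul_nonneg (sub_nonneg.2 hah) (neg_pos.2 hl).le
  have h3 := mul_pos (sub_pos.2 hla) (neg_pos.2 hh)
  have h4 := mul_nonneg h1 (sub_pos.2 hlh).le
  by_contra! hcon
  have h5 := mul_nonneg hcon (sub_pos.2 hlh).le
  nlinarith

lemma cos_lt_neg_half {t : ℝ} (h1 : 2 * π / 3 < t) (h2 : t < 4 * π / 3) : cos t < -(1 / 2) := by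
  have habs : |t - π| < π / 3 := abs_lt.2 ⟨by linarith, by linarith⟩
  have h := cos_lt_cos_of_nonneg_of_le_pi (abs_nonneg _) (by linarith [Real.pi_pos]) habs
  rw [cos_abs, cos_pi_div_three, cos_sub_pi] at h
  linarith

lemma pi_div_three_lt_of_cos_lt {θ : ℝ} (h0 : 0 ≤ θ) (h : cos θ < 1 / 2) : π / 3 < θ := by
  by_contra! hle
  have := cos_le_cos_of_nonneg_of_le_pi h0 (by linarith [Real.pi_pos]) hle
  rw [cos_pi_div_three] at this
  linarith

lemma opposite_sides_distance_lt {a b d θ φ : ℝ} (ha : a < d) (hb : b < d) (hd : 0 < d)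
    (hθ : 0 ≤ θ) (hφ : 0 ≤ φ) (hsum : θ + φ ≤ 5 * π / 6)
    (ha' : 2 * d * cos θ ≤ a) (hb' : 2 * d * cos φ ≤ b) :
    (d - a * cos θ - b * cos φ) ^ 2 + (a * sin θ - b * sin φ) ^ 2 < d ^ 2 := by
  have hpi := Real.pi_pos
  have hc1 : cos θ < 1 / 2 := by nlinarith
  have hc2 : cos φ < 1 / 2 := by nlinarith
  have hθ3 := pi_div_three_lt_of_cos_lt hθ hc1
  have hφ3 := pi_div_three_lt_of_cos_lt hφ hc2
  have p1 : 0 < cos θ := cos_pos_of_mem_Ioo ⟨by linarith, by linarith⟩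
  have p2 : 0 < cos φ := cos_pos_of_mem_Ioo ⟨by linarith, by linarith⟩
  have hC : cos (θ + φ) < -(1 / 2) := cos_lt_neg_half (by linarith) (by linarith)
  have k1 : 1 - 2 * cos θ + 4 * cos φ * cos (θ + φ) < 0 := by
    have h := cos_lt_neg_half (t := (θ + φ) + φ) (by linarith) (by linarith)
    have h' : cos θ = cos ((θ + φ) - φ) := by ring_nf
    rw [cos_add] at h
    rw [cos_sub] at h'
    linarith
  have k2 : 1 - 2 * cos φ + 4 * cos θ * cos (θ + φ) < 0 := by
    have h := cos_lt_neg_half (t := (θ + φ) + θ) (by linarith) (by linarith)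
    have h' : cos φ = cos ((θ + φ) - θ) := by ring_nf
    rw [cos_add] at h
    rw [cos_sub] at h'
    linarith
  have k3 : 2 - 2 * cos θ - 2 * cos φ + 2 * cos (θ + φ) < 0 := by
    have hs : 0 < cos ((θ + φ) / 2) := cos_pos_of_mem_Ioo ⟨by linarith, by linarith⟩
    have hst : cos ((θ + φ) / 2) < cos ((θ - φ) / 2) := by
      rw [← cos_abs ((θ - φ) / 2)]
      exact cos_lt_cos_of_nonneg_of_le_pi (abs_nonneg _) (by linarith)
        (abs_lt.2 ⟨by linarith, by linarith⟩)
    have e1 := cos_add_cos θ φ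
    have e2 := cos_sq ((θ + φ) / 2)
    rw [mul_div_cancel₀ _ (two_ne_zero' ℝ)] at e2
    nlinarith
  have hs1 := sin_sq_add_cos_sq θ
  have hs2 := sin_sq_add_cos_sq φ
  have hadd := cos_add θ φ
  generalize cos (θ + φ) = C at *
  generalize cos θ = c₁ at *
  generalize cos φ = c₂ at *
  have dd : 0 < d ^ 2 := by positivity
  have l1 : 2 * d * c₁ < d := by nlinarith
  have l2 : 2 * d * c₂ < d := by nlinarith
  have key : a ^ 2 + (-2 * d * c₁ + 2 * b * C) * a + (b ^ 2 - 2 * b * d * c₂) < 0 := by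
    refine monic_quadratic_neg l1 ha' ha.le ?_ ?_
    · have := monic_quadratic_neg (p := -2 * d * c₂ + 4 * d * c₁ * C) (q := 0) l2 hb' hb.le
        (by nlinarith [mul_pos (mul_pos dd (mul_pos p1 p2)) (by linarith : 0 < -C)])
        (by nlinarith)
      linarith
    · have := monic_quadratic_neg (p := -2 * d * c₂ + 2 * d * C) (q := d ^ 2 - 2 * d ^ 2 * c₁)
        l2 hb' hb.le (by nlinarith) (by nlinarith)
      linarith
  rw [hadd] at key
  linear_combination key + a ^ 2 * hs1 + b ^ 2 * hs2

/-- Among two nodes on the same side of the line `uv`, in directions making angles with total at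
most `5π/6` with the segment `uv`, one obtains a pair closer than `u, v`. -/
lemma not_far_of_same_side {f g D x y : EPlane} {θ φ : ℝ} (hfg : IsFrame f g)
    (hD : 0 < ‖D‖) (hDf : inner ℝ D f = ‖D‖) (hDg : inner ℝ D g = 0)
    (hθ : 0 ≤ θ) (hφ : 0 ≤ φ) (hsum : θ + φ ≤ 5 * π / 6)
    (hxf : inner ℝ x f = ‖x‖ * cos θ) (hxg : inner ℝ x g = ‖x‖ * sin θ)
    (hyf : inner ℝ y (-f) = ‖y‖ * cos φ) (hyg : inner ℝ y g = ‖y‖ * sin φ)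
    (hx0 : x ≠ 0) (hy0 : y ≠ 0) (hx : ‖x‖ < ‖D‖) (hy : ‖y‖ < ‖D‖)
    (h1 : ‖D‖ ≤ ‖x - D‖) (h2 : ‖D‖ ≤ ‖D + y‖) : ‖x - (D + y)‖ < ‖D‖ := by
  rw [inner_neg_right] at hyf
  replace hyf : inner ℝ y f = -(‖y‖ * cos φ) := by linarith
  rw [← sq_le_sq₀ hD.le (norm_nonneg _), hfg.1 (x - D), inner_sub_left, inner_sub_left, hxf, hxg,
    hDf, hDg] at h1
  rw [← sq_le_sq₀ hD.le (norm_nonneg _), hfg.1 (D + y), inner_add_left, inner_add_left, hyf, hyg,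
    hDf, hDg] at h2
  rw [← sq_lt_sq₀ (norm_nonneg _) hD.le, hfg.1 (x - (D + y))]
  simp only [inner_sub_left, inner_add_left, hxf, hxg, hyf, hyg, hDf, hDg]
  have px := norm_pos_iff.2 hx0
  have py := norm_pos_iff.2 hy0
  have hs1 := sin_sq_add_cos_sq θ
  have hs2 := sin_sq_add_cos_sq φ
  have ha' : 2 * ‖D‖ * cos θ ≤ ‖x‖ := by
    refine le_of_mul_le_mul_left ?_ px
    linear_combination h1 + ‖x‖ ^ 2 * hs1
  have hb' : 2 * ‖D‖ * cos φ ≤ ‖y‖ := by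
    refine le_of_mul_le_mul_left ?_ py
    linear_combination h2 + ‖y‖ ^ 2 * hs2
  linear_combination opposite_sides_distance_lt hx hy hD hθ hφ hsum ha' hb'

/-- If `u` and `v` have no `5π/6`-gap among the nodes closer than `dist u v`, then there are
nodes `u'` near `u` and `v'` near `v` that are closer to each other than `u` and `v`. -/
lemma exists_closer_pair (V : Finset EPlane) (u v : EPlane) (hu : u ∈ V) (hv : v ∈ V)
    (huv : u ≠ v)
    (hgu : ∀ e : EPlane, e ≠ 0 → ∃ w ∈ V, w ≠ u ∧ dist u w < dist u v ∧
      InnerProductGeometry.angle (w - u) e ≤ 5 * π / 12)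
    (hgv : ∀ e : EPlane, e ≠ 0 → ∃ w ∈ V, w ≠ v ∧ dist v w < dist u v ∧
      InnerProductGeometry.angle (w - v) e ≤ 5 * π / 12) :
    ∃ u' ∈ V, ∃ v' ∈ V, dist u u' < dist u v ∧ dist v v' < dist u v ∧
      dist u' v' < dist u v := by
  by_contra! hfar
  obtain ⟨f, g, hfg, hDf, hDg⟩ := exists_isFrame (v - u) (sub_ne_zero.2 huv.symm)
  have hD : 0 < ‖v - u‖ := norm_pos_iff.2 (sub_ne_zero.2 huv.symm)
  have hdist : dist u v = ‖v - u‖ := by rw [dist_comm, dist_eq_norm]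
  have enclose : ∀ z : EPlane, ∀ f' : EPlane, IsFrame f' g →
      (∀ e : EPlane, e ≠ 0 → ∃ w ∈ V, w ≠ z ∧ dist z w < dist u v ∧
        InnerProductGeometry.angle (w - z) e ≤ 5 * π / 12) →
      ∃ x y : EPlane, (x + z ∈ V ∧ x ≠ 0 ∧ ‖x‖ < ‖v - u‖) ∧ (y + z ∈ V ∧ y ≠ 0 ∧ ‖y‖ < ‖v - u‖) ∧
        ∃ ψ χ : ℝ, 0 ≤ ψ ∧ 0 ≤ χ ∧ ψ + χ ≤ 5 * π / 6 ∧
        inner ℝ x f' = ‖x‖ * cos ψ ∧ inner ℝ x g = ‖x‖ * sin ψ ∧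
        inner ℝ y f' = ‖y‖ * cos χ ∧ inner ℝ y (-g) = ‖y‖ * sin χ := by
    intro z f' hf' hgap
    have hS : ∀ x ∈ (V.filter fun w => w ≠ z ∧ dist z w < dist u v).image (fun w => w - z),
        x + z ∈ V ∧ x ≠ 0 ∧ ‖x‖ < ‖v - u‖ := by
      intro x hx
      obtain ⟨w, hw, rfl⟩ := Finset.mem_image.1 hx
      obtain ⟨hwV, hwz, hwd⟩ := Finset.mem_filter.1 hw
      refine ⟨by simpa using hwV, sub_ne_zero.2 hwz, ?_⟩
      rwa [hdist, dist_comm, dist_eq_norm] at hwd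
    obtain ⟨x, hx, y, hy, h⟩ := exists_enclosing_vectors hf' _ (fun x hx => (hS x hx).2.1) (by
      intro e he
      obtain ⟨w, hw, hwz, hwd, hang⟩ := hgap e he
      exact ⟨w - z, Finset.mem_image_of_mem _ (Finset.mem_filter.2 ⟨hw, hwz, hwd⟩), hang⟩)
    exact ⟨x, y, hS x hx, hS y hy, h⟩
  have contra : ∀ (g' x y : EPlane) (θ φ : ℝ), IsFrame f g' → inner ℝ (v - u) g' = 0 →
      (x + u ∈ V ∧ x ≠ 0 ∧ ‖x‖ < ‖v - u‖) → (y + v ∈ V ∧ y ≠ 0 ∧ ‖y‖ < ‖v - u‖) →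
      0 ≤ θ → 0 ≤ φ → θ + φ ≤ 5 * π / 6 →
      inner ℝ x f = ‖x‖ * cos θ → inner ℝ x g' = ‖x‖ * sin θ →
      inner ℝ y (-f) = ‖y‖ * cos φ → inner ℝ y g' = ‖y‖ * sin φ → False := by
    intro g' x y θ φ hfg' hDg' hx hy hθ hφ hsum h1 h2 h3 h4
    have dx : dist u (x + u) < dist u v := by
      rw [hdist, dist_comm, dist_eq_norm, add_sub_cancel_right]; exact hx.2.2
    have dy : dist v (y + v) < dist u v := by
      rw [hdist, dist_comm, dist_eq_norm, add_sub_cancel_right]; exact hy.2.2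
    have du : dist u u < dist u v := by rw [dist_self]; exact dist_pos.2 huv
    have dv : dist v v < dist u v := by rw [dist_self]; exact dist_pos.2 huv
    have e1 := hfar _ hx.1 v hv dx dv
    have e2 := hfar u hu _ hy.1 du dy
    have e3 := hfar _ hx.1 _ hy.1 dx dy
    rw [hdist, dist_eq_norm, show x + u - v = x - (v - u) by abel] at e1
    rw [hdist, dist_comm, dist_eq_norm, show y + v - u = v - u + y by abel] at e2
    rw [hdist, dist_eq_norm, show x + u - (y + v) = x - (v - u + y) by abel] at e3
    exact absurd e3 (not_le.2 (not_far_of_same_side hfg' hD hDf hDg' hθ hφ hsum h1 h2 h3 h4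
      hx.2.1 hy.2.1 hx.2.2 hy.2.2 e1 e2))
  obtain ⟨x₁, y₁, hx₁, hy₁, ψ₁, χ₁, pψ₁, pχ₁, s₁, a₁, b₁, c₁, d₁⟩ := enclose u f hfg hgu
  obtain ⟨x₂, y₂, hx₂, hy₂, ψ₂, χ₂, pψ₂, pχ₂, s₂, a₂, b₂, c₂, d₂⟩ :=
    enclose v (-f) hfg.neg_left hgv
  rcases le_total (ψ₁ + ψ₂) (5 * π / 6) with h | h
  · exact contra g x₁ x₂ ψ₁ ψ₂ hfg hDg hx₁ hx₂ pψ₁ pψ₂ h a₁ b₁ a₂ b₂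
  · exact contra (-g) y₁ y₂ χ₁ χ₂ hfg.neg_right (by rw [inner_neg_right, hDg, neg_zero]) hy₁ hy₂
      pχ₁ pχ₂ (by linarith) c₁ d₁ c₂ d₂

lemma dist_lt_of_angle_lt_pi_div_three {u v w : EPlane} (huw : u ≠ w)
    (hle : dist u w ≤ dist u v) (hang : ∠ v u w < π / 3) : dist w v < dist u v := by
  have hcos := cos_lt_cos_of_nonneg_of_le_pi (angle_nonneg v u w)
    (by linarith [Real.pi_pos]) hang
  rw [cos_pi_div_three] at hcos
  have hlaw := EuclideanGeometry.law_cos v u w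
  have hw : 0 < dist u w := dist_pos.2 huw
  rw [dist_comm v w, dist_comm v u, dist_comm w u] at hlaw
  have hprod : 0 < dist u v * dist u w := mul_pos (hw.trans_le hle) hw
  refine lt_of_pow_lt_pow_left₀ 2 dist_nonneg ?_
  nlinarith

/-- The edge ID as an element of a linear order. -/
def eidKey (nid : EPlane → ℕ) (p : EPlane × EPlane) : ℝ ×ₗ ℕ ×ₗ ℕ :=
  toLex (dist p.1 p.2, toLex (max (nid p.1) (nid p.2), min (nid p.1) (nid p.2)))

lemma eidLt_iff (nid : EPlane → ℕ) (u v w x : EPlane) :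
    EidLt nid u v w x ↔ eidKey nid (u, v) < eidKey nid (w, x) := by
  simp [EidLt, eidKey, Prod.Lex.toLex_lt_toLex]

lemma eidLt_induction (nid : EPlane → ℕ) (V : Finset EPlane) (P : EPlane → EPlane → Prop)
    (h : ∀ u ∈ V, ∀ v ∈ V, (∀ w ∈ V, ∀ x ∈ V, EidLt nid w x u v → P w x) → P u v) :
    ∀ u ∈ V, ∀ v ∈ V, P u v := by
  have hwf : Set.IsWF (((V ×ˢ V).image (eidKey nid) : Finset (ℝ ×ₗ ℕ ×ₗ ℕ)) :
      Set (ℝ ×ₗ ℕ ×ₗ ℕ)) :=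
    (Finset.finite_toSet _).isWF
  have main : ∀ k ∈ (V ×ˢ V).image (eidKey nid), ∀ u ∈ V, ∀ v ∈ V, eidKey nid (u, v) = k →
      P u v := by
    intro k hk
    refine Set.WellFoundedOn.induction (P := fun k => ∀ u ∈ V, ∀ v ∈ V, eidKey nid (u, v) = k →
      P u v) hwf (Finset.mem_coe.2 hk) ?_
    rintro _ - ih u hu v hv rfl
    refine h u hu v hv fun w hw x hx hlt => ?_
    exact ih _ (Finset.mem_coe.2 (Finset.mem_image_of_mem _ (Finset.mk_mem_product hw hx)))
      ((eidLt_iff nid w x u v).1 hlt) w hw x hx rfl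
  exact fun u hu v hv =>
    main _ (Finset.mem_image_of_mem _ (Finset.mk_mem_product hu hv)) u hu v hv rfl

lemma GAlphaNrAdj.symm {V : Finset EPlane} {r : EPlane → ℝ} {nid : EPlane → ℕ} {u v : EPlane}
    (h : GAlphaNrAdj V r nid u v) : GAlphaNrAdj V r nid v u := by
  obtain ⟨⟨hu, hv, huv, hd⟩, h1, h2⟩ := h
  exact ⟨⟨hv, hu, huv.symm, by rwa [dist_comm, max_comm]⟩, h2, h1⟩

/-- Pairwise (redundant) edge removal: for `0 < α ≤ 5π/6`, a CBTC(α)-valid radius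
assignment and injective IDs, the graph `G_α^{nr}` preserves the connectivity
of `G_R`. -/
theorem cbtc_redundant_removal_connectivity (α R : ℝ) (hα : 0 < α)
    (hα' : α ≤ 5 * Real.pi / 6) (hR : 0 < R) (V : Finset EPlane) (r : EPlane → ℝ)
    (hr : CBTCValid α R V r) (nid : EPlane → ℕ) (hnid : Set.InjOn nid ↑V)
    (u v : EPlane) (hu : u ∈ V) (hv : v ∈ V) :
    Relation.ReflTransGen (GAlphaNrAdj V r nid) u v ↔
      Relation.ReflTransGen (GRAdj R V) u v := by
  constructor
  · refine Relation.ReflTransGen.mono ?_ u v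
    rintro a b ⟨⟨ha, hb, hab, hd⟩, -⟩
    exact ⟨ha, hb, hab, hd.trans (max_le (hr a ha).1.2 (hr b hb).1.2)⟩
  · have key : ∀ a ∈ V, ∀ b ∈ V, dist a b ≤ R → Relation.ReflTransGen (GAlphaNrAdj V r nid) a b := by
      refine eidLt_induction nid V _ fun a ha b hb ih hab => ?_
      have symm {x y : EPlane} (h : Relation.ReflTransGen (GAlphaNrAdj V r nid) x y) :
          Relation.ReflTransGen (GAlphaNrAdj V r nid) y x :=
        Relation.ReflTransGen.mono (fun _ _ => GAlphaNrAdj.symm) _ _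
          (Relation.reflTransGen_swap.2 h)
      have short : ∀ x ∈ V, ∀ y ∈ V, dist x y < dist a b →
          Relation.ReflTransGen (GAlphaNrAdj V r nid) x y := fun x hx y hy h =>
        ih x hx y hy (Or.inl h) (h.le.trans hab)
      rcases eq_or_ne a b with rfl | hne
      · exact .refl
      by_cases hadj : GAlphaAdj V r a b
      · by_cases h1 : Redundant V r nid a b
        · obtain ⟨-, w, ⟨-, hw, haw, -⟩, hang, hlt⟩ := h1
          have hle : dist a w ≤ dist a b := hlt.elim le_of_lt fun h => h.1.le
          exact (ih a ha w hw hlt (hle.trans hab)).trans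
            (short w hw b hb (dist_lt_of_angle_lt_pi_div_three haw hle hang))
        by_cases h2 : Redundant V r nid b a
        · obtain ⟨-, w, ⟨-, hw, hbw, -⟩, hang, hlt⟩ := h2
          have hle : dist b w ≤ dist b a := hlt.elim le_of_lt fun h => h.1.le
          have hlt' : EidLt nid b w a b := by
            unfold EidLt at hlt ⊢
            rwa [dist_comm a b, max_comm (nid a), min_comm (nid a)]
          have hwa := dist_lt_of_angle_lt_pi_div_three hbw hle hang
          rw [dist_comm b a] at hle hwa
          exact symm ((ih b hb w hw hlt' (hle.trans hab)).trans (short w hw a ha hwa))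
        exact .single ⟨hadj, h1, h2⟩
      · have hmax : max (r a) (r b) < dist a b := by
          by_contra! h
          exact hadj ⟨ha, hb, hne, h⟩
        obtain ⟨hra, hrb⟩ := max_lt_iff.1 hmax
        have gap : ∀ z ∈ V, r z < dist a b → ∀ e : EPlane, e ≠ 0 → ∃ w ∈ V, w ≠ z ∧
            dist z w < dist a b ∧ InnerProductGeometry.angle (w - z) e ≤ 5 * π / 12 := by
          intro z hz hrz e he
          obtain ⟨w, hw, hwz, hd, hang⟩ :=
            (hr z hz).2.resolve_left (hrz.trans_le hab).ne e he
          exact ⟨w, hw, hwz, hd.trans_lt hrz, by linarith⟩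
        obtain ⟨a', ha', b', hb', h1, h2, h3⟩ :=
          exists_closer_pair V a b ha hb hne (gap a ha hra) (gap b hb hrb)
        exact ((short a ha a' ha' h1).trans (short a' ha' b' hb' h3)).trans
          (symm (short b hb b' hb' h2))
    intro h
    induction h with
    | refl => exact .refl
    | tail _ hbc ih => exact (ih hbc.1).trans (key _ hbc.1 _ hbc.2.1 hbc.2.2.2)
end
end
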